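/- arXiv:math/0304403 — 2 statements merged into one kernel-verified Lean document; each statement's English description precedes it below -/
import Mathlib

section
/- For all integers n ≥ 3 and d ≥ 0, the following identity of rational numbers holds: Σ over all integer chains 0 = j₀ ≤ j₁ ≤ ⋯ ≤ j_{n−3} ≤ d of d!^{n−2} / ( (d − j_{n−3})! · ∏_{i=1}^{n−3} [ (d − j_i)! · (j_i − j_{i−1})! · j_i! ] ) equals ((−1)^d / 2) · Σ_{m=0}^{d} C(d,m)^n · ( n·(d − 2m)·(γ(m) − γ(d−m)) + 2 ). (For n = 3 the left-hand side is the single term 1, coming from the empty chain.) -/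
open Finset
open scoped Classical

/-- `gam m` is the `m`-th harmonic number `γ(m) = Σ_{j=1}^m 1/j`, with `γ(0) = 0`. -/
def gam (m : ℕ) : ℚ := ∑ j ∈ Finset.range m, (1 : ℚ) / (j + 1)

def bc (x : ℚ) (k : ℕ) : ℚ := (∏ i ∈ range k, (x - i)) / k.factorial

lemma bc_eq (x : ℚ) (k : ℕ) : bc x k = Ring.choose x k := by
  rw [Ring.choose_eq_smul, bc, ← descPochhammer_eval_eq_prod_range, smul_eq_mul, div_eq_inv_mul,
    ← descPochhammer_map (Int.castRingHom ℚ) k, Polynomial.eval_map, ← Polynomial.eval₂_smulOneHom_eq_smeval]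
  congr 2
  exact Subsingleton.elim _ _

lemma bc_nat (n k : ℕ) : bc (n : ℚ) k = (n.choose k : ℚ) := by
  rw [bc_eq, Ring.choose_natCast]

lemma bc_vand (x y : ℚ) (k : ℕ) :
    ∑ s ∈ range (k+1), bc x s * bc y (k - s) = bc (x + y) k := by
  simp only [bc_eq]
  rw [Ring.add_choose_eq k (Commute.all x y), Finset.Nat.sum_antidiagonal_eq_sum_range_succ_mk]

/-- Gosper sum. -/
def ee (x : ℚ) (k j : ℕ) : ℚ :=
  (-1) ^ k * (j.choose k : ℚ) * (2 * k - x) / ∏ l ∈ range (j + 1), ((k : ℚ) + l - x)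

lemma ee_zero (x : ℚ) (k j : ℕ) (h : j < k) : ee x k j = 0 := by
  simp [ee, Nat.choose_eq_zero_of_lt h]

lemma ee_tele (x : ℚ) (hx : ∀ n : ℕ, (n : ℚ) - x ≠ 0) (j K : ℕ) :
    ∑ k ∈ range (K + 1), ee x k (j + 1) =
      (-1) ^ K * (j.choose K : ℚ) / ∏ l ∈ range (j + 1), ((K : ℚ) + 1 + l - x) := by
  have hp : ∀ (K j : ℕ), ∏ l ∈ range j, ((K : ℚ) + l - x) ≠ 0 := fun K j => by
    refine Finset.prod_ne_zero_iff.2 fun l _ => ?_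
    have := hx (K + l); push_cast at this; exact this
  induction K with
  | zero =>
    have h0 := hx 0
    have h1 := hp 1 (j+1)
    simp only [zero_add, sum_range_one, ee, prod_range_succ' _ (j+1)]
    push_cast at h0 h1 ⊢
    simp only [add_zero, zero_add, pow_zero, Nat.choose_zero_right, Nat.cast_one, mul_zero, one_mul] at h0 h1 ⊢
    have : ∏ k ∈ range (j + 1), ((k:ℚ) + 1 - x) = ∏ l ∈ range (j + 1), (1 + (l:ℚ) - x) :=
      prod_congr rfl fun _ _ => by ring
    rw [this]
    field_simp
  | succ K ih =>
    rw [sum_range_succ, ih, ee]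
    have a1 : ∏ l ∈ range (j + 1 + 1), (((K+1:ℕ) : ℚ) + l - x) =
        (∏ l ∈ range (j + 1), ((K : ℚ) + 1 + l - x)) * (K + j + 2 - x) := by
      rw [prod_range_succ]; push_cast; ring
    have a2 : ∏ l ∈ range (j + 1 + 1), (((K+1:ℕ) : ℚ) + l - x) =
        (∏ l ∈ range (j + 1), (((K + 1 : ℕ) : ℚ) + 1 + l - x)) * (K + 1 - x) := by
      rw [prod_range_succ']; push_cast
      congr 1
      · exact prod_congr rfl fun _ _ => by ring
      · ring
    have n1 := hp (K+1) (j+1)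
    have n2 := hp (K+2) (j+1)
    have e2 : ((K+2:ℕ):ℚ) = ((K+1:ℕ):ℚ) + 1 := by push_cast; ring
    rw [e2] at n2
    have n3 := hp (K+1) (j+2)
    have n4 := hx (K+1)
    have n5 := hx (K+j+2)
    have b1 : (∏ l ∈ range (j + 1), ((K : ℚ) + 1 + l - x))⁻¹ =
      (K + j + 2 - x) * (∏ l ∈ range (j + 1 + 1), (((K+1:ℕ) : ℚ) + l - x))⁻¹ := by
      push_cast at n5
      rw [a1]; push_cast at n1; field_simp
    have b2 : (∏ l ∈ range (j + 1), (((K+1:ℕ) : ℚ) + 1 + l - x))⁻¹ =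
      (K + 1 - x) * (∏ l ∈ range (j + 1 + 1), (((K+1:ℕ) : ℚ) + l - x))⁻¹ := by
      push_cast at n4
      rw [a2]; field_simp
    rw [div_eq_mul_inv, b1, div_eq_mul_inv, div_eq_mul_inv, b2]
    have c1 : ((j+1).choose (K+1) : ℚ) = j.choose K + j.choose (K+1) := by
      rw [Nat.choose_succ_succ]; push_cast; ring
    have c2 : (j.choose (K+1) : ℚ) * (K+1) = j.choose K * (j - K) := by
      rcases le_or_gt K j with h | h
      · have := Nat.choose_succ_right_eq j K
        have h2 : ((j - K : ℕ) : ℚ) = j - K := by push_cast [h]; ring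
        rw [← h2]; exact_mod_cast this
      · rw [Nat.choose_eq_zero_of_lt h, Nat.choose_eq_zero_of_lt (by omega)]; simp
    rw [c1]; push_cast
    rw [pow_succ]
    linear_combination (-(-1)^K) * (∏ l ∈ range (j + 1 + 1), ((K:ℚ) + 1 + l - x))⁻¹ * c2

lemma ee_sum (x : ℚ) (hx : ∀ n : ℕ, (n : ℚ) - x ≠ 0) (d j : ℕ) (hj : j ≤ d) :
    ∑ k ∈ range (d + 1), ee x k j = if j = 0 then 1 else 0 := by
  rw [← Finset.sum_subset (s₁ := range (j+1)) (by simpa using hj)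
    (fun k _ hk => ee_zero x k j (by simpa using hk))]
  cases j with
  | zero => have := hx 0; simp at this; simp [ee, this]
  | succ j => rw [ee_tele x hx]; simp

lemma ee_eigen (x : ℚ) (hx : ∀ n : ℕ, (n : ℚ) - x ≠ 0) (k j : ℕ) :
    ∑ i ∈ range (j + 1), bc x i / ((j - i).factorial : ℚ) * ee x k i = bc x k * ee x k j := by
  have hp : ∀ (K j : ℕ), ∏ l ∈ range j, ((K : ℚ) + l - x) ≠ 0 := fun K j => by
    refine Finset.prod_ne_zero_iff.2 fun l _ => ?_
    have := hx (K + l); push_cast at this; exact this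
  rcases lt_or_ge j k with h | h
  · rw [ee_zero x k j h, mul_zero]
    refine sum_eq_zero fun i hi => ?_
    rw [ee_zero x k i (by simp at hi; omega), mul_zero]
  obtain ⟨M, rfl⟩ := Nat.exists_eq_add_of_le h
  rw [add_assoc, sum_range_add, sum_eq_zero, zero_add]
  swap
  · intro i hi
    rw [ee_zero x k i (by simpa using hi), mul_zero]
  have hv := bc_vand (x - k) (k + M - (x - k)) M
  rw [show x - k + (k + M - (x - k)) = ((k + M : ℕ) : ℚ) by push_cast; ring, bc_nat] at hv
  have key : ∀ s ∈ range (M+1), bc x (k+s) / ((k + M - (k+s)).factorial : ℚ) * ee x k (k+s) =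
     bc x k * ((-1)^k * (2*k-x) / ∏ l ∈ range (k + M + 1), ((k : ℚ) + l - x)) *
      (bc (x-k) s * bc (k + M - (x - k)) (M - s)) := by
    intro s hs
    have hs : s ≤ M := by simpa using Nat.lt_succ_iff.1 (mem_range.1 hs)
    obtain ⟨t, rfl⟩ := Nat.exists_eq_add_of_le hs
    have e1 : bc x (k+s) * ((k+s).choose k : ℚ) = bc x k * bc (x-k) s := by
      rw [bc, bc, bc, prod_range_add, Nat.cast_add_choose]
      have : ∏ i ∈ range s, (x - ((k+i:ℕ):ℚ)) = ∏ i ∈ range s, (x - k - i) :=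
        prod_congr rfl fun _ _ => by push_cast; ring
      rw [this]; field_simp
    have e2 : bc (k + ((s+t:ℕ):ℚ) - (x-k)) t = 
        (∏ l ∈ range t, ((k:ℚ) + ((k + s + 1 + l : ℕ):ℚ) - x)) / t.factorial := by
      rw [bc, ← prod_range_reflect]
      congr 1
      refine prod_congr rfl fun i hi => ?_
      have : i + 1 ≤ t := mem_range.1 hi
      rw [show t - 1 - i = t - (i+1) by omega]; push_cast [this]; ring
    rw [show k + (s+t) - (k+s) = t by omega, show s + t - s = t by omega, e2,
      show k + (s+t) + 1 = (k+s+1) + t by ring, prod_range_add, ee]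
    have q1 := hp k (k+s+1)
    have q2 : ∏ l ∈ range t, ((k:ℚ) + ((k + s + 1 + l : ℕ):ℚ) - x) ≠ 0 := by
      have := hp k (k+s+1+t)
      rw [prod_range_add] at this
      exact right_ne_zero_of_mul this
    field_simp
    linear_combination (2 * (k:ℚ) - x) * e1
  rw [sum_congr rfl key, ← mul_sum, hv, ee]
  rw [← Nat.choose_symm_add]
  ring

def WW (w : ℕ → ℚ) : ℕ → ℕ → ℚ
  | 0, j => if j = 0 then 1 else 0
  | r+1, j => ∑ i ∈ range (j+1), w i / ((j - i).factorial : ℚ) * WW w r i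

lemma WW_eq (x : ℚ) (hx : ∀ n : ℕ, (n : ℚ) - x ≠ 0) (d r : ℕ) : ∀ j ≤ d, 
    WW (bc x) r j = ∑ k ∈ range (d + 1), ee x k j * bc x k ^ r := by
  induction r with
  | zero => intro j hj; simp [WW, ee_sum x hx d j hj]
  | succ r ih =>
    intro j hj
    rw [WW]
    have : ∀ i ∈ range (j+1), bc x i / ((j - i).factorial : ℚ) * WW (bc x) r i = 
      ∑ k ∈ range (d+1), (bc x i / ((j - i).factorial : ℚ) * ee x k i) * bc x k ^ r := by
      intro i hi
      rw [ih i (by simp at hi; omega), mul_sum]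
      exact sum_congr rfl fun _ _ => by ring
    rw [sum_congr rfl this, sum_comm]
    refine sum_congr rfl fun k _ => ?_
    rw [← sum_mul, ee_eigen x hx]; ring

lemma chain_sum (w : ℕ → ℚ) (h0 : w 0 = 1) (N m : ℕ) : ∀ F : ℕ → ℚ,
    ∑ j ∈ (Fintype.piFinset fun _ : Fin (m + 1) => Finset.range (N + 1)).filter
        (fun j => Monotone j ∧ j 0 = 0),
      F (j (Fin.last m)) * ∏ i : Fin m, (w (j i.succ) / ((j i.succ - j i.castSucc).factorial : ℚ)) =
    ∑ j ∈ range (N+1), F j * (w j * WW w m j) := by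
  induction m with
  | zero =>
    intro F
    rw [sum_eq_single (0 : ℕ)]
    · rw [sum_eq_single (fun _ => 0)]
      · simp [WW, h0]
      · intro b hb hne
        exfalso; apply hne
        simp at hb
        funext i
        rw [show i = 0 from Fin.fin_one_eq_zero i]; exact hb.2.2
      · intro h; exfalso; apply h; simp [monotone_const]
    · intro b _ hb; simp [WW, hb]
    · simp
  | succ m ih =>
    intro F
    have step : ∑ j ∈ (Fintype.piFinset fun _ : Fin (m + 1 + 1) => Finset.range (N + 1)).filter
        (fun j => Monotone j ∧ j 0 = 0),
      F (j (Fin.last (m+1))) * ∏ i : Fin (m+1), (w (j i.succ) / ((j i.succ - j i.castSucc).factorial : ℚ)) =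
      ∑ p ∈ (range (N+1) ×ˢ (Fintype.piFinset fun _ : Fin (m + 1) => Finset.range (N + 1)).filter
        (fun j => Monotone j ∧ j 0 = 0)).filter (fun p => p.2 (Fin.last m) ≤ p.1),
        F p.1 * (w p.1 / ((p.1 - p.2 (Fin.last m)).factorial : ℚ)) *
          ∏ i : Fin m, (w (p.2 i.succ) / ((p.2 i.succ - p.2 i.castSucc).factorial : ℚ)) := by
      refine sum_nbij' (fun g => (g (Fin.last (m+1)), fun i => g i.castSucc))
        (fun p => Fin.snoc (α := fun _ => ℕ) p.2 p.1) ?_ ?_ ?_ ?_ ?_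
      · intro g hg
        simp only [mem_filter, Fintype.mem_piFinset, mem_product] at hg ⊢
        refine ⟨⟨hg.1 _, fun _ => hg.1 _, fun a b hab => hg.2.1 (by simpa using hab), ?_⟩, ?_⟩
        · simpa using hg.2.2
        · exact hg.2.1 (Fin.le_last _)
      · rintro ⟨a, f⟩ hp
        simp only [mem_filter, Fintype.mem_piFinset, mem_product] at hp ⊢
        obtain ⟨⟨ha, hf, hmono, hz⟩, hle⟩ := hp
        refine ⟨?_, ?_, ?_⟩
        · intro i
          refine Fin.lastCases ?_ (fun i => ?_) i
          · simpa using ha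
          · simpa using hf i
        · rw [Fin.monotone_iff_le_succ]
          intro i
          refine Fin.lastCases ?_ (fun i => ?_) i
          · simpa using hle
          · rw [← Fin.castSucc_succ]
            simp only [Fin.snoc_castSucc]
            exact hmono (Fin.castSucc_le_succ i)
        · have : (0 : Fin (m+2)) = Fin.castSucc 0 := rfl
          rw [this, Fin.snoc_castSucc]; exact hz
      · intro g _
        exact Fin.snoc_init_self g
      · rintro ⟨a, f⟩ _
        simp
      · intro g _
        rw [Fin.prod_univ_castSucc]
        simp only [Fin.succ_last, Fin.castSucc_succ, Nat.succ_eq_add_one]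
        ring
    rw [step, sum_filter, sum_product]
    refine sum_congr rfl fun a ha => ?_
    have := ih (fun t => if t ≤ a then F a * (w a / ((a - t).factorial : ℚ)) else 0)
    simp only [ite_mul, zero_mul] at this
    rw [this, WW, ← sum_filter]
    have hs : (range (N+1)).filter (fun t => t ≤ a) = range (a+1) := by
      ext t; simp at ha ⊢; omega
    rw [hs, mul_sum, mul_sum]
    refine sum_congr rfl fun _ _ => by ring

lemma hd_prod {ι : Type*} (s : Finset ι) (f : ι → ℚ → ℚ) (L : ι → ℚ) (x : ℚ)
    (h : ∀ i ∈ s, HasDerivAt (f i) (f i x * L i) x) :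
    HasDerivAt (fun y => ∏ i ∈ s, f i y) ((∏ i ∈ s, f i x) * ∑ i ∈ s, L i) x := by
  classical
  induction s using Finset.induction_on with
  | empty => simpa using hasDerivAt_const x (1:ℚ)
  | insert a s ha ih =>
    simp only [prod_insert ha, sum_insert ha]
    have h1 := h a (mem_insert_self a s)
    have h2 := ih fun i hi => h i (mem_insert_of_mem hi)
    refine (h1.fun_mul h2).congr_deriv ?_
    ring

lemma hd_lin (a x : ℚ) (h : a - x ≠ 0) :
    HasDerivAt (fun y => a - y) ((a - x) * (-1 / (a - x))) x := by
  have := (hasDerivAt_id x).const_sub a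
  refine this.congr_deriv ?_
  field_simp

lemma hd_lin' (a x : ℚ) (h : x - a ≠ 0) :
    HasDerivAt (fun y => y - a) ((x - a) * (1 / (x - a))) x := by
  have := (hasDerivAt_id x).sub_const a
  refine this.congr_deriv ?_
  field_simp

lemma bc_deriv (k e : ℕ) : HasDerivAt (fun y => bc y k)
    (((k+e).choose k : ℚ) * (gam (k + e) - gam e)) ((k+e : ℕ) : ℚ) := by
  have h := hd_prod (range k) (fun i y => y - (i:ℚ)) (fun i => 1 / (((k+e:ℕ):ℚ) - i))
    ((k+e:ℕ):ℚ) (fun i hi => hd_lin' _ _ (by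
      have : i < k := mem_range.1 hi
      have : (i:ℚ) < k := by exact_mod_cast this
      push_cast
      have : (0:ℚ) ≤ e := by positivity
      linarith))
  have h2 := h.div_const (k.factorial : ℚ)
  refine h2.congr_deriv ?_
  have : gam (k+e) - gam e = ∑ i ∈ range k, 1 / (((k+e:ℕ):ℚ) - i) := by
    rw [← sum_range_reflect, gam, gam, add_comm k e, sum_range_add, add_sub_cancel_left]
    refine sum_congr rfl fun i hi => ?_
    have : i + 1 ≤ k := mem_range.1 hi
    rw [show k - 1 - i = k - (i+1) by omega]; push_cast [this]; ring
  rw [this, ← bc_nat, bc]; ring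

def den (k e : ℕ) (x : ℚ) : ℚ :=
  (∏ l ∈ range e, ((k:ℚ) + l - x)) * ∏ i ∈ range k, ((k:ℚ) + e + 1 + i - x)

lemma den_eq (k e : ℕ) (x : ℚ) : ∏ l ∈ range (k + e + 1), ((k:ℚ) + l - x) =
    (((k + e : ℕ):ℚ) - x) * den k e x := by
  rw [show k + e + 1 = e + 1 + k by ring, prod_range_add, prod_range_succ, den]
  have : ∏ i ∈ range k, ((k:ℚ) + ((e + 1 + i:ℕ):ℚ) - x) =
    ∏ i ∈ range k, ((k:ℚ) + e + 1 + i - x) := prod_congr rfl fun _ _ => by push_cast; ring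
  rw [this]; push_cast; ring

lemma den_val (k e : ℕ) : den k e ((k + e : ℕ):ℚ) = (-1)^e * e.factorial * k.factorial := by
  rw [den]
  congr 1
  · rw [← prod_range_reflect, ← prod_range_add_one_eq_factorial]
    push_cast
    rw [← card_range e, ← prod_const, card_range, ← prod_mul_distrib]
    refine prod_congr rfl fun i hi => ?_
    have : i + 1 ≤ e := mem_range.1 hi
    rw [show e - 1 - i = e - (i+1) by omega]; push_cast [this]; ring
  · rw [← prod_range_add_one_eq_factorial]
    push_cast
    exact prod_congr rfl fun i hi => by ring

lemma den_deriv (k e : ℕ) : HasDerivAt (den k e)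
    (den k e ((k + e : ℕ):ℚ) * (gam e - gam k)) ((k+e : ℕ) : ℚ) := by
  have h1 := hd_prod (range e) (fun l y => (k:ℚ) + l - y) (fun i => -1 / ((k:ℚ) + i - ((k+e:ℕ):ℚ)))
    ((k+e:ℕ):ℚ) (fun i hi => hd_lin _ _ (by
      have : i < e := mem_range.1 hi
      have : (i:ℚ) < e := by exact_mod_cast this
      push_cast
      linarith))
  have h2 := hd_prod (range k) (fun l y => (k:ℚ) + e + 1 + l - y)
    (fun i => -1 / ((k:ℚ) + e + 1 + i - ((k+e:ℕ):ℚ)))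
    ((k+e:ℕ):ℚ) (fun i hi => hd_lin _ _ (by
      push_cast
      have : (0:ℚ) ≤ i := by positivity
      linarith))
  have h := h1.fun_mul h2
  have s1 : ∑ i ∈ range e, -1 / ((k:ℚ) + i - ((k+e:ℕ):ℚ)) = gam e := by
    rw [← sum_range_reflect, gam]
    refine sum_congr rfl fun i hi => ?_
    have : i + 1 ≤ e := mem_range.1 hi
    rw [show e - 1 - i = e - (i+1) by omega]; push_cast [this]
    rw [show (k:ℚ) + (e - (i+1)) - (k+e) = -(i+1) by ring, neg_div_neg_eq]
  have s2 : ∑ i ∈ range k, -1 / ((k:ℚ) + e + 1 + i - ((k+e:ℕ):ℚ)) = - gam k := by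
    rw [gam, ← sum_neg_distrib]
    refine sum_congr rfl fun i hi => ?_
    push_cast
    rw [show (k:ℚ) + e + 1 + i - (k+e) = i+1 by ring, neg_div]
  rw [s1, s2] at h
  refine h.congr_deriv ?_
  rw [den]; ring

def gg (r d k : ℕ) (x : ℚ) : ℚ :=
  (-1) ^ k * (d.choose k : ℚ) * (2 * k - x) * bc x k ^ r / den k (d - k) x

lemma gg_deriv (r d k : ℕ) (hk : k ≤ d) : HasDerivAt (gg r d k)
    ((-1)^d * (d.choose k : ℚ)^(r+2) / d.factorial *
      (-1 + (2*k-d) * (r * (gam d - gam (d-k)) + (gam k - gam (d-k))))) (d : ℚ) := by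
  obtain ⟨e, rfl⟩ := Nat.exists_eq_add_of_le hk
  have hden : den k e ((k + e : ℕ):ℚ) ≠ 0 := by
    rw [den_val]; positivity
  have h1 := (hasDerivAt_id (((k+e:ℕ):ℚ))).const_sub (2 * (k:ℚ))
  have h := (((h1.const_mul ((-1) ^ k * ((k+e).choose k : ℚ))).fun_mul
    ((bc_deriv k e).fun_pow r)).fun_div (den_deriv k e) hden)
  unfold gg
  rw [show k + e - k = e by omega]
  refine h.congr_deriv ?_
  rw [bc_nat, den_val]
  have hc : ((k+e).choose k : ℚ) = (k+e).factorial / (k.factorial * e.factorial) :=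
    Nat.cast_add_choose ℚ
  have hc0 : ((k+e).choose k : ℚ) ≠ 0 := by
    have := Nat.choose_pos (Nat.le_add_right k e)
    positivity
  have hf : ((k+e).factorial : ℚ) = ((k+e).choose k : ℚ) * (k.factorial * e.factorial) := by
    rw [hc]; field_simp
  have hs : ((-1:ℚ)^e) * (-1)^e = 1 := by rw [← mul_pow]; simp
  have hr : (r:ℚ) * ((k+e).choose k : ℚ)^(r-1) * ((k+e).choose k : ℚ) = r * ((k+e).choose k : ℚ)^r := by
    cases r with
    | zero => simp
    | succ r => simp [pow_succ, mul_assoc]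
  have hr' : ∀ Z : ℚ, (r:ℚ) * ((k+e).choose k : ℚ)^(r-1) * (((k+e).choose k : ℚ) * Z) =
      r * ((k+e).choose k : ℚ)^r * Z := fun Z => by rw [← mul_assoc, hr]
  rw [hr', hf, pow_add (-1:ℚ) k e]
  simp only [id]
  generalize ((k+e).choose k : ℚ) = c at *
  have hk0 : (k.factorial : ℚ) ≠ 0 := by positivity
  have he0 : (e.factorial : ℚ) ≠ 0 := by positivity
  generalize (k.factorial : ℚ) = kf at *
  generalize (e.factorial : ℚ) = ef at *
  rcases neg_one_pow_eq_or ℚ e with h | h <;> rw [h] <;> field_simp <;> ring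

lemma WW_diff (r : ℕ) (x : ℚ) : ∀ j, DifferentiableAt ℚ (fun y => WW (bc y) r j) x := by
  induction r with
  | zero => intro j; simp [WW]
  | succ r ih =>
    intro j
    simp only [WW, bc]
    refine DifferentiableAt.fun_sum fun i _ => ?_
    refine DifferentiableAt.fun_mul ?_ (ih i)
    refine ((DifferentiableAt.fun_finsetProd fun l _ => ?_).div_const _).div_const _
    fun_prop

lemma WW_val (r d : ℕ) : WW (fun i => (d.choose i : ℚ)) r d =
    ∑ k ∈ range (d+1), (-1)^d * (d.choose k : ℚ)^(r+2) / d.factorial *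
      (1 - (2*k-d) * (r * (gam d - gam (d-k)) + (gam k - gam (d-k)))) := by
  have hP := (WW_diff r (d:ℚ) d).hasDerivAt
  have h1 := ((hasDerivAt_id (d:ℚ)).const_sub (d:ℚ)).fun_mul hP
  have h2 : HasDerivAt (fun x => ∑ k ∈ range (d+1), gg r d k x) _ (d:ℚ) :=
    HasDerivAt.fun_sum fun k hk => gg_deriv r d k (Nat.lt_succ_iff.1 (mem_range.1 hk))
  have key : (fun x => ∑ k ∈ range (d+1), gg r d k x) =ᶠ[nhds (d:ℚ)]
      (fun x => ((d:ℚ) - id x) * WW (bc x) r d) := by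
    rw [← h2.continuousAt.eventuallyEq_nhds_iff_eventuallyEq_nhdsNE h1.continuousAt]
    have hball : ∀ᶠ x in nhdsWithin (d:ℚ) {(d:ℚ)}ᶜ, x ∈ Set.Ioo ((d:ℚ)-1) (d+1) :=
      nhdsWithin_le_nhds (Ioo_mem_nhds (by linarith) (by linarith))
    filter_upwards [hball, self_mem_nhdsWithin] with x hx hne
    have hx' : ∀ n : ℕ, (n:ℚ) - x ≠ 0 := by
      intro n hn
      have hn : x = n := by linarith
      subst hn
      have a1 : d < n + 1 := by have := hx.1; exact_mod_cast (by linarith : (d:ℚ) < n + 1)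
      have a2 : n < d + 1 := by exact_mod_cast hx.2
      apply hne
      have : n = d := by omega
      simp [this]
    rw [WW_eq x hx' d r d le_rfl, mul_sum]
    refine sum_congr rfl fun k hk => ?_
    obtain ⟨e, rfl⟩ := Nat.exists_eq_add_of_le (Nat.lt_succ_iff.1 (mem_range.1 hk))
    rw [ee, gg, den_eq, show k + e - k = e by omega]
    have := hx' (k+e)
    simp only [id]
    rw [div_mul_eq_mul_div, ← mul_div_assoc, mul_div_mul_left _ _ this]
  have := (h1.congr_of_eventuallyEq key).unique h2
  simp only [id, sub_self, zero_mul, add_zero, neg_mul, one_mul] at this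
  have hb : bc (d:ℚ) = fun i => (d.choose i : ℚ) := by funext i; exact bc_nat d i
  rw [hb, neg_eq_iff_eq_neg, ← sum_neg_distrib] at this
  rw [this]
  exact sum_congr rfl fun _ _ => by ring

theorem stanton_identity (m d : ℕ) :
    (∑ j ∈ (Fintype.piFinset fun _ : Fin (m + 1) => Finset.range (d + 1)).filter
        (fun j => Monotone j ∧ j 0 = 0),
      ((d.factorial : ℚ)) ^ (m + 1) /
        (((d - j (Fin.last m)).factorial : ℚ) *
          ∏ i : Fin m,
            (((d - j i.succ).factorial : ℚ) *
              ((j i.succ - j i.castSucc).factorial : ℚ) *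
              ((j i.succ).factorial : ℚ)))) =
    ((-1 : ℚ) ^ d / 2) *
      ∑ k ∈ Finset.range (d + 1),
        (d.choose k : ℚ) ^ (m + 3) *
          (((m : ℚ) + 3) * ((d : ℚ) - 2 * k) * (gam k - gam (d - k)) + 2) := by
  have hd0 : (d.factorial : ℚ) ≠ 0 := by positivity
  have hL := chain_sum (fun i => (d.choose i : ℚ)) (by simp) d m
    (fun t => (d.factorial : ℚ) / ((d - t).factorial : ℚ))
  have hL' : ∑ j ∈ range (d+1), (d.factorial : ℚ) / ((d - j).factorial : ℚ) *
      ((d.choose j : ℚ) * WW (fun i => (d.choose i : ℚ)) m j) =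
      d.factorial * WW (fun i => (d.choose i : ℚ)) (m+1) d := by
    rw [WW, mul_sum]
    exact sum_congr rfl fun _ _ => by ring
  rw [hL'] at hL
  trans (d.factorial * WW (fun i => (d.choose i : ℚ)) (m+1) d)
  · rw [← hL]
    refine sum_congr rfl fun j hj => ?_
    simp only [mem_filter, Fintype.mem_piFinset, mem_range] at hj
    have hprod : ∏ i : Fin m, ((d.choose (j i.succ) : ℚ) / ((j i.succ - j i.castSucc).factorial : ℚ)) =
        (d.factorial : ℚ)^m / ∏ i : Fin m,
            (((d - j i.succ).factorial : ℚ) *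
              ((j i.succ - j i.castSucc).factorial : ℚ) *
              ((j i.succ).factorial : ℚ)) := by
      have : (d.factorial : ℚ)^m = ∏ i : Fin m, (d.factorial : ℚ) := by simp
      rw [this, ← prod_div_distrib]
      refine prod_congr rfl fun i _ => ?_
      rw [Nat.cast_choose ℚ (Nat.lt_succ_iff.1 (hj.1 i.succ)), div_div]
      congr 1; ring
    rw [hprod, div_mul_div_comm, pow_succ']
  · rw [WW_val, mul_sum, mul_sum]
    -- symmetrize
    have hsym := sum_range_reflect (fun k => (d.factorial : ℚ) * ((-1)^d * (d.choose k : ℚ)^(m+1+2) / d.factorial *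
      (1 - (2*k-d) * (((m+1:ℕ):ℚ) * (gam d - gam (d-k)) + (gam k - gam (d-k)))))) (d+1)
    have : ∀ A B : ℚ, A = B → A = (A + B)/2 := fun A B h => by rw [← h]; ring
    rw [this _ _ hsym.symm, ← sum_add_distrib, sum_div]
    refine sum_congr rfl fun k hk => ?_
    have hk : k ≤ d := Nat.lt_succ_iff.1 (mem_range.1 hk)
    rw [show d + 1 - 1 - k = d - k by omega, Nat.choose_symm hk, Nat.sub_sub_self hk]
    push_cast [hk]
    field_simp
    ring
end

section
/- Fix integers 1 ≤ r ≤ n. Let R be a commutative ring and c ∈ R. Then h_n · Δ − c · Δ lies in the ideal I_P(c) of R[x₁,…,x_r] generated by x₁^n − c, …, x_r^n − c. -/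
open Finset MvPolynomial

/-- The complete homogeneous symmetric polynomial of degree `k` in the variables
`x₁, …, x_r`: the sum of all monomials of total degree `k`. -/
noncomputable def hsymm (R : Type*) [CommRing R] (r k : ℕ) : MvPolynomial (Fin r) R :=
  ∑ d ∈ (Fintype.piFinset fun _ : Fin r => Finset.range (k + 1)).filter
      (fun d => ∑ i, d i = k),
    ∏ i, X i ^ d i

/-- The Vandermonde determinant `Δ = ∏_{1 ≤ i < j ≤ r} (xᵢ - xⱼ)`. -/
noncomputable def vander (R : Type*) [CommRing R] (r : ℕ) : MvPolynomial (Fin r) R :=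
  ∏ p ∈ Finset.univ.filter (fun p : Fin r × Fin r => p.1 < p.2), (X p.1 - X p.2)

/-- The ideal `I_P(c) = ⟨x₁ⁿ - c, …, x_rⁿ - c⟩` of `R[x₁,…,x_r]`. -/
noncomputable def IP (R : Type*) [CommRing R] (r n : ℕ) (c : R) :
    Ideal (MvPolynomial (Fin r) R) :=
  Ideal.span (Set.range fun i : Fin r => X i ^ n - C c)

/-- Geometric series `1/(1-aT)`. -/
noncomputable def geoS {A : Type*} [CommRing A] (a : A) : PowerSeries A :=
  PowerSeries.mk fun m => a ^ m

lemma geoS_eq {A : Type*} [CommRing A] (a : A) : geoS a = 1 + PowerSeries.C a * PowerSeries.X * geoS a := by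
  ext m
  cases m with
  | zero => simp [geoS, mul_assoc]
  | succ m =>
    rw [mul_assoc, map_add, PowerSeries.coeff_C_mul, PowerSeries.coeff_succ_X_mul]
    simp [geoS, PowerSeries.coeff_one, pow_succ']

lemma geoS_sub {A : Type*} [CommRing A] (a b : A) :
    geoS a - geoS b = PowerSeries.C (a - b) * (PowerSeries.X * (geoS a * geoS b)) := by
  have ha := geoS_eq a
  have hb := geoS_eq b
  rw [map_sub]
  linear_combination geoS b * ha - geoS a * hb

/-- Vandermonde product of a list. -/
def listV {A : Type*} [CommRing A] : List A → A
  | [] => 1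
  | a :: l => (l.map fun b => a - b).prod * listV l

lemma key {A : Type*} [CommRing A] (I : Ideal A) (c : A) (n : ℕ) (l : List A) :
    ∀ (a : A) (_ : ∀ x ∈ a :: l, x ^ n - c ∈ I) (k : ℕ),
    listV (a :: l) * (PowerSeries.coeff (k + n) ((a :: l).map geoS).prod
      - c * PowerSeries.coeff k ((a :: l).map geoS).prod) ∈ I := by
  induction l with
  | nil =>
    intro a h k
    have := I.mul_mem_left (a ^ k) (h a (by simp))
    simp only [listV, List.map_nil, List.prod_nil, List.map_cons, List.prod_cons, mul_one, geoS,
      PowerSeries.coeff_mk]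
    convert this using 1
    ring
  | cons b l ih =>
    intro a h k
    have h1 := ih a (fun x hx => h x (by simp at hx ⊢; tauto)) (k + 1)
    have h2 := ih b (fun x hx => h x (by simp at hx ⊢; tauto)) (k + 1)
    have hc : ∀ k, (a - b) * PowerSeries.coeff k ((a :: b :: l).map geoS).prod =
        PowerSeries.coeff (k + 1) ((a :: l).map geoS).prod
          - PowerSeries.coeff (k + 1) ((b :: l).map geoS).prod := by
      intro k
      rw [← map_sub, List.map_cons, List.map_cons, List.map_cons,
        List.prod_cons, List.prod_cons, List.prod_cons, ← sub_mul, geoS_sub,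
        mul_assoc, PowerSeries.coeff_C_mul, mul_assoc, PowerSeries.coeff_succ_X_mul, mul_assoc]
    have e1 := hc (k + n)
    have e2 := hc k
    rw [show k + 1 + n = k + n + 1 by ring] at h1 h2
    have := I.sub_mem (I.mul_mem_left (l.map fun x => b - x).prod h1)
      (I.mul_mem_left (l.map fun x => a - x).prod h2)
    convert this using 1
    simp only [listV, List.map_cons, List.prod_cons] at e1 e2 ⊢
    linear_combination (l.map fun x => a - x).prod * (l.map fun x => b - x).prod * listV l
      * (e1 - c * e2)

lemma listV_ofFn {A : Type*} [CommRing A] (r : ℕ) (v : Fin r → A) :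
    listV (List.ofFn v) = ∏ i, ∏ j ∈ Ioi i, (v i - v j) := by
  induction r with
  | zero => simp [listV]
  | succ r ih =>
    rw [List.ofFn_succ, listV, ih, Fin.prod_univ_succ, Fin.prod_Ioi_zero, List.map_ofFn,
      List.prod_ofFn]
    simp [Fin.prod_Ioi_succ]

lemma vander_eq (R : Type*) [CommRing R] (r : ℕ) :
    vander R r = listV (List.ofFn fun i : Fin r => (X i : MvPolynomial (Fin r) R)) := by
  rw [listV_ofFn, vander, Finset.prod_filter, ← Finset.univ_product_univ, Finset.prod_product]
  refine Finset.prod_congr rfl fun i _ => ?_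
  rw [← Finset.prod_filter]
  refine Finset.prod_congr ?_ fun _ _ => rfl
  ext; simp

lemma hsymm_eq (R : Type*) [CommRing R] (r k : ℕ) :
    hsymm R r k = PowerSeries.coeff k
      ((List.ofFn fun i : Fin r => (X i : MvPolynomial (Fin r) R)).map geoS).prod := by
  rw [List.map_ofFn, List.prod_ofFn, PowerSeries.coeff_prod, _root_.hsymm]
  refine Finset.sum_bij' (fun d _ => Finsupp.equivFunOnFinite.symm d) (fun d _ => ⇑d) ?_ ?_ ?_ ?_ ?_
  · intro d hd
    simp at hd ⊢
    exact hd.2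
  · intro d hd
    simp at hd ⊢
    refine ⟨fun i => ?_, hd⟩
    have := Finset.single_le_sum (f := d) (fun _ _ => Nat.zero_le _) (Finset.mem_univ i)
    have hd2 : ∑ x, d x = k := hd
    omega
  · intros; ext; simp
  · intros; ext; simp
  · intros; simp [geoS]

/-- For `1 ≤ r ≤ n`, a commutative ring `R` and `c ∈ R`, the polynomial
`h_n · Δ - c · Δ` lies in the ideal `I_P(c) = ⟨x₁ⁿ - c, …, x_rⁿ - c⟩`. -/
theorem hn_mul_vandermonde_sub_mem (n r : ℕ) (hr : 1 ≤ r) (hrn : r ≤ n)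
    (R : Type*) [CommRing R] (c : R) :
    hsymm R r n * vander R r - C c * vander R r ∈ IP R r n c := by
  obtain ⟨s, rfl⟩ : ∃ s, r = s + 1 := ⟨r - 1, by omega⟩
  have h0 : hsymm R (s + 1) 0 = 1 := by
    rw [hsymm_eq, List.map_ofFn, List.prod_ofFn, PowerSeries.coeff_zero_eq_constantCoeff_apply,
      map_prod]
    refine Finset.prod_eq_one fun i _ => ?_
    rw [← PowerSeries.coeff_zero_eq_constantCoeff_apply]
    simp [geoS]
  have hk := key (IP R (s + 1) n c) (C c) n
    (List.ofFn fun i : Fin s => (X i.succ : MvPolynomial (Fin (s + 1)) R)) (X 0) (by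
      intro x hx
      rw [← List.ofFn_succ (f := fun i => (X i : MvPolynomial (Fin (s + 1)) R)),
        List.mem_ofFn] at hx
      obtain ⟨i, rfl⟩ := hx
      exact Ideal.subset_span ⟨i, rfl⟩) 0
  rw [← List.ofFn_succ (f := fun i => (X i : MvPolynomial (Fin (s + 1)) R)), ← hsymm_eq,
    ← hsymm_eq, ← vander_eq, h0, zero_add] at hk
  convert hk using 1
  ring
end
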